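/- For every truncation function τ there exists a constant κ > 0, depending only on τ, with the following property: for every σ-finite measure space (T, 𝒯, A), every measurable kernel K from (T, 𝒯) to (ℝ, 𝓑(ℝ)) with ∫_ℝ min(1, y²) K(t, dy) < ∞ for all t ∈ T, and all measurable functions b, H, G: T → ℝ with |G(t)| ≤ 1 for all t ∈ T, one has ∫_T |G(t)H(t)b(t) + ∫_ℝ (τ(G(t)H(t)y) − G(t)H(t)τ(y)) K(t, dy)| A(dt) ≤ ∫_T |H(t)b(t) + ∫_ℝ (τ(H(t)y) − H(t)τ(y)) K(t, dy)| A(dt) + κ · ∫_T ∫_ℝ min(1, (H(t)y)²) K(t, dy) A(dt). -/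

import Mathlib

open MeasureTheory ProbabilityTheory

lemma min_one_mul_sq_le (a y : ℝ) :
    min 1 ((a * y) ^ 2) ≤ (1 + a ^ 2) * min 1 (y ^ 2) := by
  rcases le_total 1 (y ^ 2) with h | h
  · rw [min_eq_left h]
    exact (min_le_left _ _).trans (by nlinarith [sq_nonneg a])
  · rw [min_eq_right h]
    exact (min_le_right _ _).trans (by nlinarith [sq_nonneg y])

lemma integrable_min_one_mul_sq {ν : Measure ℝ}
    (hν : Integrable (fun y : ℝ => min 1 (y ^ 2)) ν) (a : ℝ) :
    Integrable (fun y : ℝ => min 1 ((a * y) ^ 2)) ν := by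
  refine (hν.const_mul (1 + a ^ 2)).mono' (by fun_prop) (.of_forall fun y => ?_)
  rw [Real.norm_of_nonneg (by positivity)]
  exact min_one_mul_sq_le a y

lemma continuous_integral_min_one_mul_sq {ν : Measure ℝ}
    (hν : Integrable (fun y : ℝ => min 1 (y ^ 2)) ν) :
    Continuous fun a : ℝ => ∫ y, min 1 ((a * y) ^ 2) ∂ν := by
  refine continuous_iff_continuousAt.2 fun a => ?_
  refine continuousAt_of_dominated (bound := fun y => (1 + (|a| + 1) ^ 2) * min 1 (y ^ 2))
    (.of_forall fun c => by fun_prop) ?_ (hν.const_mul _)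
    (.of_forall fun y => by fun_prop)
  filter_upwards [Metric.ball_mem_nhds a one_pos] with c hc
  refine .of_forall fun y => ?_
  rw [Real.norm_of_nonneg (by positivity)]
  refine (min_one_mul_sq_le c y).trans ?_
  have hca : |c| ≤ |a| + 1 := by
    rw [Metric.mem_ball, Real.dist_eq] at hc
    linarith [abs_sub_abs_le_abs_sub c a]
  have : c ^ 2 ≤ (|a| + 1) ^ 2 := by
    rw [← sq_abs c]
    gcongr
  gcongr

/-- No s-finiteness of the kernel is needed, since the integral is continuous in the scale. -/
lemma measurable_integral_min_one_mul_sq {T : Type*} [MeasurableSpace T] {K : Kernel T ℝ}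
    (hK : ∀ t : T, Integrable (fun y : ℝ => min 1 (y ^ 2)) (K t))
    {H : T → ℝ} (hH : Measurable H) :
    Measurable fun t => ∫ y, min 1 ((H t * y) ^ 2) ∂(K t) := by
  have key : Measurable (Function.uncurry fun (a : ℝ) (t : T) =>
      ∫ y, min 1 ((a * y) ^ 2) ∂(K t)) := by
    refine measurable_uncurry_of_continuous_of_measurable
      (fun t => continuous_integral_min_one_mul_sq (hK t)) fun a => ?_
    have h (t : T) : ∫ y, min 1 ((a * y) ^ 2) ∂(K t)
        = (∫⁻ y, ENNReal.ofReal (min 1 ((a * y) ^ 2)) ∂(K t)).toReal :=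
      integral_eq_lintegral_of_nonneg_ae (.of_forall fun y => by positivity) (by fun_prop)
    simp_rw [h]
    exact ((Measure.measurable_lintegral (by fun_prop)).comp K.measurable).ennreal_toReal
  exact key.comp (hH.prodMk measurable_id)

lemma abs_truncation_sub_le {τ : ℝ → ℝ} {B δ : ℝ} (hB : ∀ u, |τ u| ≤ B) (hδ : 0 < δ)
    (hτ : ∀ u, |u| ≤ δ → τ u = u) {a : ℝ} (ha : |a| ≤ 1) (x : ℝ) :
    |τ (a * x) - a * τ x| ≤ 2 * B * (1 + (δ ^ 2)⁻¹) * min 1 (x ^ 2) := by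
  have hB0 : 0 ≤ B := (abs_nonneg _).trans (hB 0)
  rcases le_or_gt |x| δ with h | h
  · have : |a * x| ≤ δ := by
      rw [abs_mul]
      nlinarith [abs_nonneg x]
    rw [hτ x h, hτ _ this, sub_self, abs_zero]
    positivity
  · have h1 : |τ (a * x) - a * τ x| ≤ 2 * B := by
      refine (abs_sub _ _).trans ?_
      rw [abs_mul]
      nlinarith [hB (a * x), hB x, abs_nonneg (τ x), abs_nonneg a]
    have h2 : 1 ≤ (1 + (δ ^ 2)⁻¹) * min 1 (x ^ 2) := by
      have hx : δ ^ 2 ≤ x ^ 2 := by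
        rw [← sq_abs x]
        gcongr
      have hi : 0 < (δ ^ 2)⁻¹ := by positivity
      rcases le_total 1 (x ^ 2) with h | h
      · rw [min_eq_left h]
        linarith
      · rw [min_eq_right h]
        have : (δ ^ 2)⁻¹ * δ ^ 2 = 1 := inv_mul_cancel₀ (by positivity)
        nlinarith [sq_nonneg x]
    calc _ ≤ 2 * B * 1 := by rwa [mul_one]
      _ ≤ 2 * B * ((1 + (δ ^ 2)⁻¹) * min 1 (x ^ 2)) := by gcongr
      _ = _ := by ring

lemma integrable_truncation_sub {τ : ℝ → ℝ} (hτm : Measurable τ) {B δ : ℝ}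
    (hB : ∀ u, |τ u| ≤ B) (hδ : 0 < δ) (hτ : ∀ u, |u| ≤ δ → τ u = u) {ν : Measure ℝ}
    (hν : Integrable (fun y : ℝ => min 1 (y ^ 2)) ν) (a : ℝ) :
    Integrable (fun y => τ (a * y) - a * τ y) ν := by
  have of_le {a : ℝ} (ha : |a| ≤ 1) {ρ : Measure ℝ} {c : ℝ}
      (hν : Integrable (fun y : ℝ => min 1 ((c * y) ^ 2)) ρ) :
      Integrable (fun y => τ (a * (c * y)) - a * τ (c * y)) ρ :=
    (hν.const_mul _).mono' (by fun_prop)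
      (.of_forall fun y => abs_truncation_sub_le hB hδ hτ ha (c * y))
  rcases le_total |a| 1 with ha | ha
  · simpa using of_le (c := 1) ha (by simpa using hν)
  · have ha0 : a ≠ 0 := by
      rintro rfl
      norm_num at ha
    have hai : |a⁻¹| ≤ 1 := by
      rw [abs_inv]
      exact inv_le_one_of_one_le₀ ha
    refine ((of_le hai (integrable_min_one_mul_sq hν a)).const_mul (-a)).congr
      (.of_forall fun y => ?_)
    simp only [inv_mul_cancel_left₀ ha0]
    field_simp
    ring

lemma abs_truncated_drift_le {τ : ℝ → ℝ} (hτm : Measurable τ) {B δ : ℝ}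
    (hB : ∀ u, |τ u| ≤ B) (hδ : 0 < δ) (hτ : ∀ u, |u| ≤ δ → τ u = u) {ν : Measure ℝ}
    (hν : Integrable (fun y : ℝ => min 1 (y ^ 2)) ν) (b h : ℝ) {g : ℝ} (hg : |g| ≤ 1) :
    |g * h * b + ∫ y, (τ (g * h * y) - g * h * τ y) ∂ν|
      ≤ |h * b + ∫ y, (τ (h * y) - h * τ y) ∂ν|
        + 2 * B * (1 + (δ ^ 2)⁻¹) * ∫ y, min 1 ((h * y) ^ 2) ∂ν := by
  have hi := integrable_truncation_sub hτm hB hδ hτ hν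
  have hsplit : ∫ y, (τ (g * (h * y)) - g * τ (h * y)) ∂ν
      = (∫ y, (τ (g * h * y) - g * h * τ y) ∂ν) - g * ∫ y, (τ (h * y) - h * τ y) ∂ν := by
    rw [← integral_const_mul, ← integral_sub (hi _) ((hi h).const_mul g)]
    congr 1 with y
    ring_nf
  have hbound : |∫ y, (τ (g * (h * y)) - g * τ (h * y)) ∂ν|
      ≤ 2 * B * (1 + (δ ^ 2)⁻¹) * ∫ y, min 1 ((h * y) ^ 2) ∂ν := by
    rw [← integral_const_mul]
    rw [← Real.norm_eq_abs]
    exact norm_integral_le_of_norm_le ((integrable_min_one_mul_sq hν h).const_mul _)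
      (.of_forall fun y => abs_truncation_sub_le hB hδ hτ hg (h * y))
  calc |g * h * b + ∫ y, (τ (g * h * y) - g * h * τ y) ∂ν|
      = |g * (h * b + ∫ y, (τ (h * y) - h * τ y) ∂ν)
          + ∫ y, (τ (g * (h * y)) - g * τ (h * y)) ∂ν| := by
        rw [hsplit]
        ring_nf
    _ ≤ |g| * |h * b + ∫ y, (τ (h * y) - h * τ y) ∂ν|
          + |∫ y, (τ (g * (h * y)) - g * τ (h * y)) ∂ν| := by
        rw [← abs_mul]
        exact abs_add_le _ _
    _ ≤ _ := add_le_add (mul_le_of_le_one_left (abs_nonneg _) hg) hbound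

/-- For every truncation function `τ` there is `κ > 0` such that for every
σ-finite measure space `(T, 𝒯, A)`, every measurable kernel `K` from `T` to `ℝ` with
`∫ min(1, y²) K(t, dy) < ∞` for all `t`, and all measurable `b, H, G : T → ℝ` with
`|G| ≤ 1`, the integrated drift bound
`∫ |GHb + ∫ (τ(GHy) − GHτ(y)) K(t,dy)| dA
  ≤ ∫ |Hb + ∫ (τ(Hy) − Hτ(y)) K(t,dy)| dA + κ ∫ ∫ min(1, (Hy)²) K(t,dy) dA`
holds (stated with outer lower integrals so that both sides may be infinite). -/
theorem truncation_drift_domination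
    (τ : ℝ → ℝ) (hτ_meas : Measurable τ)
    (hτ_bdd : ∃ B : ℝ, ∀ u : ℝ, |τ u| ≤ B)
    (hτ_id : ∃ δ > (0 : ℝ), ∀ u : ℝ, |u| ≤ δ → τ u = u) :
    ∃ κ > (0 : ℝ),
      ∀ (T : Type) [MeasurableSpace T] (A : Measure T) [SigmaFinite A]
        (K : Kernel T ℝ),
        (∀ t : T, Integrable (fun y : ℝ => min 1 (y ^ 2)) (K t)) →
        ∀ (b H G : T → ℝ), Measurable b → Measurable H → Measurable G →
        (∀ t : T, |G t| ≤ 1) →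
        (∫⁻ t, ENNReal.ofReal
            |G t * H t * b t + ∫ y, (τ (G t * H t * y) - G t * H t * τ y) ∂(K t)| ∂A)
          ≤ (∫⁻ t, ENNReal.ofReal
                |H t * b t + ∫ y, (τ (H t * y) - H t * τ y) ∂(K t)| ∂A)
            + ENNReal.ofReal κ *
              ∫⁻ t, ENNReal.ofReal (∫ y, min 1 ((H t * y) ^ 2) ∂(K t)) ∂A := by
  obtain ⟨B, hB⟩ := hτ_bdd
  obtain ⟨δ, hδ, hτ⟩ := hτ_id
  have hB0 : 0 < B := by
    refine lt_of_lt_of_le ?_ (hB δ)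
    rw [hτ δ (abs_of_pos hδ).le]
    exact abs_pos.2 hδ.ne'
  have hκ : 0 < 2 * B * (1 + (δ ^ 2)⁻¹) := by positivity
  refine ⟨_, hκ, fun T _ A _ K hK b H G _ hH _ hG => ?_⟩
  have hm := (measurable_integral_min_one_mul_sq hK hH).ennreal_ofReal
  rw [← lintegral_const_mul _ hm, ← lintegral_add_right _ (hm.const_mul _)]
  refine lintegral_mono fun t => ?_
  rw [← ENNReal.ofReal_mul hκ.le, ← ENNReal.ofReal_add (abs_nonneg _)
    (mul_nonneg hκ.le (integral_nonneg fun y => by positivity))]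
  exact ENNReal.ofReal_le_ofReal
    (abs_truncated_drift_le hτ_meas hB hδ hτ (hK t) (b t) (H t) (hG t))
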